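/- arXiv:2305.18659 — 2 statements merged into one kernel-verified Lean document; each statement's English description precedes it below -/
import Mathlib

section
/- Let Ω₊ ⊆ Ω ⊆ ℝⁿ be open sets, let Ω₋ := Ω \ closure(Ω₊), and suppose Γ := Ω \ (Ω₊ ∪ Ω₋) = ∂Ω₋ ∩ Ω = ∂Ω₊ ∩ Ω is a C²-regular interface. Let H₋ be a degenerate elliptic second-order operator on Ω₋ ∪ Γ and let H₊ be a degenerate elliptic second-order operator on Ω₊ ∪ Γ that is uniformly elliptic with respect to some [λ,Λ] ⊆ (0,∞). Then a function u ∈ C(Ω) is a viscosity sub-solution (respectively super-solution, respectively solution) of the relaxed transmission problem for (H₋, H₊, Ω₋, Ω₊, Γ) if and only if u is a viscosity sub-solution (respectively super-solution, respectively solution) of the strong problem {H₋u = 0 in Ω₋ ∪ Γ, H₊u = 0 in Ω₊}. -/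
open Metric Set Filter Topology Bornology

noncomputable section

abbrev Euc (n : ℕ) := EuclideanSpace ℝ (Fin n)

/-- Hessian matrix of a function at a point (second iterated Fréchet derivative,
a purely local notion). -/
def hessianMatrix {n : ℕ} (φ : Euc n → ℝ) (x : Euc n) : Matrix (Fin n) (Fin n) ℝ :=
  Matrix.of fun i j =>
    iteratedFDeriv ℝ 2 φ x ![EuclideanSpace.single i (1 : ℝ), EuclideanSpace.single j (1 : ℝ)]

/-- Evaluation of a second-order operator on a C² function. -/
def evalOp2 {n : ℕ} (H : Matrix (Fin n) (Fin n) ℝ → Euc n → ℝ → Euc n → ℝ)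
    (φ : Euc n → ℝ) (x : Euc n) : ℝ :=
  H (hessianMatrix φ x) (gradient φ x) (φ x) x

/-- Degenerate ellipticity of a second-order operator on `S`. -/
def DegElliptic2 {n : ℕ} (S : Set (Euc n))
    (H : Matrix (Fin n) (Fin n) ℝ → Euc n → ℝ → Euc n → ℝ) : Prop :=
  ∀ M₁ M₂ : Matrix (Fin n) (Fin n) ℝ, ∀ p : Euc n, ∀ z₁ z₂ : ℝ, ∀ x ∈ S,
    (M₁ - M₂).PosSemidef → z₁ ≤ z₂ → H M₁ p z₁ x ≤ H M₂ p z₂ x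

/-- Continuity of a second-order operator on `Sym × ℝⁿ × ℝ × S`. -/
def ContinuousOp2 {n : ℕ} (S : Set (Euc n))
    (H : Matrix (Fin n) (Fin n) ℝ → Euc n → ℝ → Euc n → ℝ) : Prop :=
  ContinuousOn
    (fun q : (Matrix (Fin n) (Fin n) ℝ) × Euc n × ℝ × Euc n => H q.1 q.2.1 q.2.2.1 q.2.2.2)
    (univ ×ˢ univ ×ˢ univ ×ˢ S)

/-- The set of symmetric matrices `A` with `λ I ≤ A ≤ Λ I`. -/
def pucciSet (n : ℕ) (l L : ℝ) : Set (Matrix (Fin n) (Fin n) ℝ) :=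
  {A | (A - l • (1 : Matrix (Fin n) (Fin n) ℝ)).PosSemidef ∧
       ((L • (1 : Matrix (Fin n) (Fin n) ℝ)) - A).PosSemidef}

/-- Pucci maximal operator `𝓜⁺_{λ,Λ}`. -/
def pucciPlus {n : ℕ} (l L : ℝ) (M : Matrix (Fin n) (Fin n) ℝ) : ℝ :=
  sSup ((fun A : Matrix (Fin n) (Fin n) ℝ => -(A * M).trace) '' pucciSet n l L)

/-- Pucci minimal operator `𝓜⁻_{λ,Λ}`. -/
def pucciMinus {n : ℕ} (l L : ℝ) (M : Matrix (Fin n) (Fin n) ℝ) : ℝ :=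
  sInf ((fun A : Matrix (Fin n) (Fin n) ℝ => -(A * M).trace) '' pucciSet n l L)

/-- Uniform ellipticity of a second-order operator with respect to `[λ, Λ]` on `S`. -/
def UnifElliptic2 {n : ℕ} (l L : ℝ) (S : Set (Euc n))
    (H : Matrix (Fin n) (Fin n) ℝ → Euc n → ℝ → Euc n → ℝ) : Prop :=
  ∀ M₁ M₂ : Matrix (Fin n) (Fin n) ℝ, ∀ p₁ p₂ : Euc n, ∀ z₁ z₂ : ℝ, ∀ x ∈ S,
    pucciMinus l L (M₂ - M₁) - L * ‖p₂ - p₁‖ - L * max (-(z₂ - z₁)) 0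
        ≤ H M₂ p₂ z₂ x - H M₁ p₁ z₁ x ∧
      H M₂ p₂ z₂ x - H M₁ p₁ z₁ x
        ≤ pucciPlus l L (M₂ - M₁) + L * ‖p₂ - p₁‖ + L * max (z₂ - z₁) 0

/-- `φ` is an admissible C² test function touching `u` from above at `x₀` on `ball x₀ r ⊆ Ω`. -/
def SubTest {n : ℕ} (Ω : Set (Euc n)) (u : Euc n → ℝ) (x₀ : Euc n)
    (φ : Euc n → ℝ) (r : ℝ) : Prop :=
  0 < r ∧ ball x₀ r ⊆ Ω ∧ ContDiffOn ℝ 2 φ (ball x₀ r) ∧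
    (∀ x ∈ ball x₀ r, u x ≤ φ x) ∧ u x₀ = φ x₀

/-- `φ` is an admissible C² test function touching `u` from below at `x₀` on `ball x₀ r ⊆ Ω`. -/
def SupTest {n : ℕ} (Ω : Set (Euc n)) (u : Euc n → ℝ) (x₀ : Euc n)
    (φ : Euc n → ℝ) (r : ℝ) : Prop :=
  0 < r ∧ ball x₀ r ⊆ Ω ∧ ContDiffOn ℝ 2 φ (ball x₀ r) ∧
    (∀ x ∈ ball x₀ r, φ x ≤ u x) ∧ u x₀ = φ x₀

/-- Viscosity sub-solution of the relaxed transmission problem (both operators second-order). -/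
def RelaxedSub2 {n : ℕ} (Ω Ωm Ωp Γ : Set (Euc n))
    (Hm Hp : Matrix (Fin n) (Fin n) ℝ → Euc n → ℝ → Euc n → ℝ) (u : Euc n → ℝ) : Prop :=
  ∀ x₀ : Euc n, ∀ φ : Euc n → ℝ, ∀ r : ℝ, SubTest Ω u x₀ φ r →
    (x₀ ∈ Ωm → evalOp2 Hm φ x₀ ≤ 0) ∧ (x₀ ∈ Ωp → evalOp2 Hp φ x₀ ≤ 0) ∧
      (x₀ ∈ Γ → min (evalOp2 Hm φ x₀) (evalOp2 Hp φ x₀) ≤ 0)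

/-- Viscosity super-solution of the relaxed transmission problem (both operators second-order). -/
def RelaxedSuper2 {n : ℕ} (Ω Ωm Ωp Γ : Set (Euc n))
    (Hm Hp : Matrix (Fin n) (Fin n) ℝ → Euc n → ℝ → Euc n → ℝ) (u : Euc n → ℝ) : Prop :=
  ∀ x₀ : Euc n, ∀ φ : Euc n → ℝ, ∀ r : ℝ, SupTest Ω u x₀ φ r →
    (x₀ ∈ Ωm → 0 ≤ evalOp2 Hm φ x₀) ∧ (x₀ ∈ Ωp → 0 ≤ evalOp2 Hp φ x₀) ∧
      (x₀ ∈ Γ → 0 ≤ max (evalOp2 Hm φ x₀) (evalOp2 Hp φ x₀))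

/-- Viscosity sub-solution of the strong problem `{H₋u ≤ 0 in Ω₋∪Γ, H₊u ≤ 0 in Ω₊}`. -/
def StrongSub2 {n : ℕ} (Ω Ωm Ωp Γ : Set (Euc n))
    (Hm Hp : Matrix (Fin n) (Fin n) ℝ → Euc n → ℝ → Euc n → ℝ) (u : Euc n → ℝ) : Prop :=
  ∀ x₀ : Euc n, ∀ φ : Euc n → ℝ, ∀ r : ℝ, SubTest Ω u x₀ φ r →
    (x₀ ∈ Ωm ∪ Γ → evalOp2 Hm φ x₀ ≤ 0) ∧ (x₀ ∈ Ωp → evalOp2 Hp φ x₀ ≤ 0)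

/-- Viscosity super-solution of the strong problem `{H₋u ≥ 0 in Ω₋∪Γ, H₊u ≥ 0 in Ω₊}`. -/
def StrongSuper2 {n : ℕ} (Ω Ωm Ωp Γ : Set (Euc n))
    (Hm Hp : Matrix (Fin n) (Fin n) ℝ → Euc n → ℝ → Euc n → ℝ) (u : Euc n → ℝ) : Prop :=
  ∀ x₀ : Euc n, ∀ φ : Euc n → ℝ, ∀ r : ℝ, SupTest Ω u x₀ φ r →
    (x₀ ∈ Ωm ∪ Γ → 0 ≤ evalOp2 Hm φ x₀) ∧ (x₀ ∈ Ωp → 0 ≤ evalOp2 Hp φ x₀)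

/-- The interface `Γ` separating `Ω₋` and `Ω₊` is C²-regular. -/
def C2Interface {n : ℕ} (Ωm Ωp Γ : Set (Euc (n + 1))) : Prop :=
  ∀ x₀ ∈ Γ, ∃ Φ Ψ : Euc (n + 1) → Euc (n + 1), ∃ U : Set (Euc (n + 1)),
    IsOpen U ∧ x₀ ∈ U ∧ Φ 0 = x₀ ∧ U = Φ '' ball 0 1 ∧
    ContDiffOn ℝ 2 Φ (ball 0 1) ∧ ContDiffOn ℝ 2 Ψ U ∧
    (∀ x ∈ ball (0 : Euc (n + 1)) 1, Ψ (Φ x) = x) ∧ (∀ y ∈ U, Φ (Ψ y) = y) ∧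
    Φ '' (ball 0 1 ∩ {x | x (Fin.last n) < 0}) = U ∩ Ωm ∧
    Φ '' (ball 0 1 ∩ {x | 0 < x (Fin.last n)}) = U ∩ Ωp ∧
    Φ '' (ball 0 1 ∩ {x | x (Fin.last n) = 0}) = U ∩ Γ

/-- `H` grows at rate at least `c` when a nonnegative multiple of a rank-one matrix is subtracted
from the Hessian variable. -/
def RankOneMono {n : ℕ} (c : ℝ) (S : Set (Euc n))
    (H : Matrix (Fin n) (Fin n) ℝ → Euc n → ℝ → Euc n → ℝ) : Prop :=
  ∀ (M : Matrix (Fin n) (Fin n) ℝ) (v p : Euc n) (z k : ℝ), ∀ x ∈ S, 0 ≤ k →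
    H M p z x + c * k * ‖v‖ ^ 2 ≤ H (M - k • Matrix.vecMulVec v v) p z x

theorem DegElliptic2.rankOneMono {n : ℕ} {S : Set (Euc n)}
    {H : Matrix (Fin n) (Fin n) ℝ → Euc n → ℝ → Euc n → ℝ} (hH : DegElliptic2 S H) :
    RankOneMono 0 S H := by
  intro M v p z k x hx hk
  have h := hH M (M - k • Matrix.vecMulVec v v) p z z x hx ?_ le_rfl
  · simpa using h
  · rw [sub_sub_cancel]
    exact (Matrix.posSemidef_vecMulVec_self_star (v : Fin n → ℝ)).smul hk

theorem UnifElliptic2.rankOneMono {n : ℕ} {l L : ℝ} (hlL : l ≤ L) {S : Set (Euc n)}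
    {H : Matrix (Fin n) (Fin n) ℝ → Euc n → ℝ → Euc n → ℝ} (hH : UnifElliptic2 l L S H) :
    RankOneMono l S H := by
  intro M v p z k x hx hk
  have h := (hH M (M - k • Matrix.vecMulVec v v) p p z z x hx).1
  have hp : l * k * ‖v‖ ^ 2 ≤ pucciMinus l L ((M - k • Matrix.vecMulVec v v) - M) := by
    apply le_csInf
    · refine ⟨_, l • (1 : Matrix (Fin n) (Fin n) ℝ), ⟨?_, ?_⟩, rfl⟩
      · rw [sub_self]; exact Matrix.PosSemidef.zero
      · rw [← sub_smul]; exact Matrix.PosSemidef.one.smul (sub_nonneg.2 hlL)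
    · rintro _ ⟨A, ⟨hA, -⟩, rfl⟩
      have hq := hA.dotProduct_mulVec_nonneg (v : Fin n → ℝ)
      have hn : ‖v‖ ^ 2 = (v : Fin n → ℝ) ⬝ᵥ v := by
        rw [EuclideanSpace.real_norm_sq_eq]
        simp [dotProduct, sq]
      have ht : (A * (M - k • Matrix.vecMulVec v v - M)).trace
          = -(k * ((v : Fin n → ℝ) ⬝ᵥ A.mulVec v)) := by
        rw [sub_sub_cancel_left, Matrix.mul_neg, Matrix.mul_smul, Matrix.trace_neg,
          Matrix.trace_smul, Matrix.mul_vecMulVec, Matrix.trace_vecMulVec, dotProduct_comm,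
          smul_eq_mul]
      simp only [star_trivial, Matrix.sub_mulVec, Matrix.smul_mulVec, Matrix.one_mulVec,
        dotProduct_sub, dotProduct_smul, smul_eq_mul] at hq
      simp only [ht, neg_neg, hn]
      nlinarith [mul_nonneg hk hq]
  simp only [sub_self, norm_zero, mul_zero, neg_zero, max_self, sub_zero] at h
  linarith

theorem hessianMatrix_apply {n : ℕ} (φ : Euc n → ℝ) (x : Euc n) (i j : Fin n) :
    hessianMatrix φ x i j = fderiv ℝ (fderiv ℝ φ) x (EuclideanSpace.single i 1)
      (EuclideanSpace.single j 1) := by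
  simp [hessianMatrix, iteratedFDeriv_two_apply]

theorem gradient_apply {n : ℕ} (φ : Euc n → ℝ) (x : Euc n) (i : Fin n) :
    gradient φ x i = fderiv ℝ φ x (EuclideanSpace.single i 1) := by
  rw [← inner_gradient_left, EuclideanSpace.inner_single_right]
  simp

theorem hessianMatrix_neg {n : ℕ} (φ : Euc n → ℝ) (x : Euc n) :
    hessianMatrix (-φ) x = -hessianMatrix φ x := by
  ext i j
  have h : fderiv ℝ (-φ) = -fderiv ℝ φ := by
    ext1 z; simp [fderiv_neg]
  simp [hessianMatrix_apply, h, fderiv_neg]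

theorem gradient_neg {n : ℕ} (φ : Euc n → ℝ) (x : Euc n) :
    gradient (-φ) x = -gradient φ x := by
  ext i
  simp [gradient_apply, fderiv_neg]

theorem ContDiffAt.continuousAt_hessianMatrix {n : ℕ} {φ : Euc n → ℝ} {x : Euc n}
    (h : ContDiffAt ℝ 2 φ x) : ContinuousAt (hessianMatrix φ) x := by
  have h2 : ContinuousAt (fderiv ℝ (fderiv ℝ φ)) x :=
    ((h.fderiv_right (m := 1) (by norm_num)).fderiv_right (m := 0) (by norm_num)).continuousAt
  refine continuousAt_pi.2 fun i => continuousAt_pi.2 fun j => ?_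
  simp only [hessianMatrix_apply]
  exact (h2.clm_apply continuousAt_const).clm_apply continuousAt_const

theorem ContDiffAt.continuousAt_gradient {n : ℕ} {φ : Euc n → ℝ} {x : Euc n}
    (h : ContDiffAt ℝ 2 φ x) : ContinuousAt (gradient φ) x :=
  (InnerProductSpace.toDual ℝ (Euc n)).symm.continuous.continuousAt.comp
    (h.fderiv_right (m := 1) (by norm_num)).continuousAt

section Perturbation

variable {n : ℕ} {φ q h : Euc n → ℝ} {x : Euc n} {f f₁ f₂ : ℝ → ℝ}

theorem fderiv_add_mul_add_comp (hφ : DifferentiableAt ℝ φ x) (hq : DifferentiableAt ℝ q x)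
    (hh : DifferentiableAt ℝ h x) (hf : ∀ t, HasDerivAt f (f₁ t) t) (η : ℝ) :
    fderiv ℝ (fun z => φ z + η * q z + f (h z)) x
      = fderiv ℝ φ x + η • fderiv ℝ q x + f₁ (h x) • fderiv ℝ h x :=
  ((hφ.hasFDerivAt.add (hq.hasFDerivAt.const_mul η)).add
    ((hf (h x)).comp_hasFDerivAt x hh.hasFDerivAt)).fderiv

theorem gradient_add_mul_add_comp (hφ : DifferentiableAt ℝ φ x) (hq : DifferentiableAt ℝ q x)
    (hh : DifferentiableAt ℝ h x) (hf : ∀ t, HasDerivAt f (f₁ t) t) (η : ℝ) :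
    gradient (fun z => φ z + η * q z + f (h z)) x
      = gradient φ x + η • gradient q x + f₁ (h x) • gradient h x := by
  ext i
  simp [gradient_apply, fderiv_add_mul_add_comp hφ hq hh hf]

theorem hessianMatrix_add_mul_add_comp (hφ : ContDiffAt ℝ 2 φ x) (hq : ContDiffAt ℝ 2 q x)
    (hh : ContDiffAt ℝ 2 h x) (hf : ∀ t, HasDerivAt f (f₁ t) t)
    (hf₁ : ∀ t, HasDerivAt f₁ (f₂ t) t) (η : ℝ) :
    hessianMatrix (fun z => φ z + η * q z + f (h z)) x
      = hessianMatrix φ x + η • hessianMatrix q x + f₁ (h x) • hessianMatrix h x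
        + f₂ (h x) • Matrix.vecMulVec (gradient h x).ofLp (gradient h x).ofLp := by
  have ev : ∀ {g : Euc n → ℝ}, ContDiffAt ℝ 2 g x → ∀ᶠ z in 𝓝 x, DifferentiableAt ℝ g z :=
    fun hg => (hg.eventually (by norm_num)).mono fun z hz => hz.differentiableAt (by norm_num)
  have d2 : ∀ {g : Euc n → ℝ}, ContDiffAt ℝ 2 g x → DifferentiableAt ℝ (fderiv ℝ g) x :=
    fun hg => (hg.fderiv_right (m := 1) (by norm_num)).differentiableAt (by norm_num)
  have e : fderiv ℝ (fun z => φ z + η * q z + f (h z)) =ᶠ[𝓝 x]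
      fun z => fderiv ℝ φ z + η • fderiv ℝ q z + f₁ (h z) • fderiv ℝ h z := by
    filter_upwards [ev hφ, ev hq, ev hh] with z h1 h2 h3
    exact fderiv_add_mul_add_comp h1 h2 h3 hf η
  have hd := (((d2 hφ).hasFDerivAt.add ((d2 hq).hasFDerivAt.const_smul η)).add
    (((hf₁ (h x)).comp_hasFDerivAt x (hh.differentiableAt (by norm_num)).hasFDerivAt).smul
      (d2 hh).hasFDerivAt))
  have key := e.fderiv_eq.trans hd.fderiv
  ext i j
  rw [hessianMatrix_apply, key]
  simp [hessianMatrix_apply, Matrix.vecMulVec_apply, gradient_apply]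
  ring

end Perturbation

/-- A C²-regular interface is locally the zero level of a C² function with nonvanishing gradient,
whose sign tells the two sides apart. -/
theorem C2Interface.exists_definingFunction {n : ℕ} {Ωm Ωp Γ : Set (Euc (n + 1))}
    (hC : C2Interface Ωm Ωp Γ) {x₀ : Euc (n + 1)} (hx₀ : x₀ ∈ Γ) :
    ∃ (h : Euc (n + 1) → ℝ) (U : Set (Euc (n + 1))), IsOpen U ∧ x₀ ∈ U ∧ ContDiffOn ℝ 2 h U ∧
      h x₀ = 0 ∧ gradient h x₀ ≠ 0 ∧
      ∀ y ∈ U, (h y < 0 → y ∈ Ωm) ∧ (0 < h y → y ∈ Ωp) ∧ (h y = 0 → y ∈ Γ) := by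
  obtain ⟨Φ, Ψ, U, hU, hxU, hΦ0, hUΦ, hΦ, hΨ, hΨΦ, -, hm, hp, h0⟩ := hC x₀ hx₀
  have b0 : (0 : Euc (n + 1)) ∈ ball (0 : Euc (n + 1)) 1 := mem_ball_self one_pos
  have hproj : ContDiff ℝ 2 (fun x : Euc (n + 1) => x (Fin.last n)) := by fun_prop
  have hh : ContDiffOn ℝ 2 (fun y => Ψ y (Fin.last n)) U := hproj.comp_contDiffOn hΨ
  refine ⟨fun y => Ψ y (Fin.last n), U, hU, hxU, hh, ?_, ?_, ?_⟩
  · simp [← hΦ0, hΨΦ 0 b0]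
  · intro hg
    have hf : fderiv ℝ (fun y => Ψ y (Fin.last n)) x₀ = 0 := by
      ext v
      rw [← inner_gradient_left, hg]
      simp
    have dh : DifferentiableAt ℝ (fun y => Ψ y (Fin.last n)) (Φ 0) := by
      rw [hΦ0]
      exact (hh.contDiffAt (hU.mem_nhds hxU)).differentiableAt (by norm_num)
    have dΦ : DifferentiableAt ℝ Φ 0 :=
      (hΦ.contDiffAt (isOpen_ball.mem_nhds b0)).differentiableAt (by norm_num)
    have e : (fun y => Ψ y (Fin.last n)) ∘ Φ =ᶠ[𝓝 0]
        (EuclideanSpace.proj (Fin.last n) : Euc (n + 1) →L[ℝ] ℝ) := by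
      filter_upwards [isOpen_ball.mem_nhds b0] with x hx
      simp [hΨΦ x hx]
    have h1 := e.fderiv_eq (𝕜 := ℝ)
    rw [fderiv_comp 0 dh dΦ, hΦ0, hf, ContinuousLinearMap.zero_comp,
      ContinuousLinearMap.fderiv] at h1
    have h2 := congrArg (fun T => T (EuclideanSpace.single (Fin.last n) (1 : ℝ))) h1
    simp at h2
  · intro y hy
    obtain ⟨x, hx, rfl⟩ : y ∈ Φ '' ball 0 1 := hUΦ ▸ hy
    simp only [hΨΦ x hx]
    exact ⟨fun h => (hm.subset ⟨x, ⟨hx, h⟩, rfl⟩).2, fun h => (hp.subset ⟨x, ⟨hx, h⟩, rfl⟩).2,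
      fun h => (h0.subset ⟨x, ⟨hx, h⟩, rfl⟩).2⟩

theorem ContinuousOp2.eventually_lt {n : ℕ} {S : Set (Euc n)}
    {H : Matrix (Fin n) (Fin n) ℝ → Euc n → ℝ → Euc n → ℝ} (hH : ContinuousOp2 S H)
    {M : Matrix (Fin n) (Fin n) ℝ} {p : Euc n} {z : ℝ} {x : Euc n} (hx : x ∈ S) {c : ℝ}
    (hc : c < H M p z x) :
    ∀ᶠ Q : Matrix (Fin n) (Fin n) ℝ × Euc n × ℝ × Euc n in 𝓝 (M, p, z, x),
      Q.2.2.2 ∈ S → c < H Q.1 Q.2.1 Q.2.2.1 Q.2.2.2 := by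
  have h := (hH (M, p, z, x) (by simpa using hx)).eventually_const_lt hc
  rw [eventually_nhdsWithin_iff] at h
  filter_upwards [h] with Q hQ hS
  exact hQ (by simpa using hS)

/-- Barrier argument: after adding a small quadratic and a boundary layer which is very concave on
the `Ω₊` side, the test function violates the relaxed conditions at a nearby maximum point. -/
theorem RelaxedSub2.evalOp2_nonpos_of_mem_interface {n : ℕ} {lam : ℝ} (hlam : 0 < lam)
    {Ω Ωp Ωm Γ : Set (Euc (n + 1))} (hC2 : C2Interface Ωm Ωp Γ)
    {Hm Hp : Matrix (Fin (n + 1)) (Fin (n + 1)) ℝ → Euc (n + 1) → ℝ → Euc (n + 1) → ℝ}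
    (hHm : RankOneMono 0 (Ωm ∪ Γ) Hm) (hHmC : ContinuousOp2 (Ωm ∪ Γ) Hm)
    (hHp : RankOneMono lam (Ωp ∪ Γ) Hp) (hHpC : ContinuousOp2 (Ωp ∪ Γ) Hp)
    {u : Euc (n + 1) → ℝ} (hu : ContinuousOn u Ω) (hsub : RelaxedSub2 Ω Ωm Ωp Γ Hm Hp u)
    {x₀ : Euc (n + 1)} (hx₀ : x₀ ∈ Γ) {φ : Euc (n + 1) → ℝ} {r : ℝ} (hφ : SubTest Ω u x₀ φ r) :
    evalOp2 Hm φ x₀ ≤ 0 := by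
  by_contra! hpos
  obtain ⟨hr, hrΩ, hφC, hle, hux⟩ := hφ
  obtain ⟨h, U, hU, hxU, hhC, hh0, hg0, hside⟩ := hC2.exists_definingFunction hx₀
  set q : Euc (n + 1) → ℝ := fun y => ‖y - x₀‖ ^ 2 with hq
  have hqC : ContDiff ℝ 2 q := (contDiff_id.sub contDiff_const).norm_sq ℝ
  set W : Set (Euc (n + 1)) := ball x₀ r ∩ U with hW
  have hWo : IsOpen W := isOpen_ball.inter hU
  have hxW : x₀ ∈ W := ⟨mem_ball_self hr, hxU⟩
  have hφW : ∀ y ∈ W, ContDiffAt ℝ 2 φ y := fun y hy =>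
    hφC.contDiffAt (isOpen_ball.mem_nhds hy.1)
  have hhW : ∀ y ∈ W, ContDiffAt ℝ 2 h y := fun y hy => hhC.contDiffAt (hU.mem_nhds hy.2)
  have huW : ContinuousOn u W := hu.mono fun y hy => hrΩ hy.1
  obtain ⟨m, hm0, hm⟩ : ∃ m : ℝ, 0 < m ∧ m < ‖gradient h x₀‖ ^ 2 :=
    exists_between (by positivity)
  set C : ℝ := |evalOp2 Hp φ x₀| + 1 with hC
  have hCpos : 0 < C := by positivity
  set K : ℝ := C / (lam * m) with hK
  have hKpos : 0 < K := by positivity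
  have hKC : lam * K * m = C := by rw [hK]; field_simp
  -- the perturbed jets
  have hP : ContinuousAt (fun a : ℝ × ℝ × Euc (n + 1) =>
      ((hessianMatrix φ a.2.2 + a.1 • hessianMatrix q a.2.2 + a.2.1 • hessianMatrix h a.2.2,
        gradient φ a.2.2 + a.1 • gradient q a.2.2 + a.2.1 • gradient h a.2.2, u a.2.2, a.2.2) :
        Matrix (Fin (n + 1)) (Fin (n + 1)) ℝ × Euc (n + 1) × ℝ × Euc (n + 1))) (0, 0, x₀) := by
    have c1 : ContinuousAt (fun a : ℝ × ℝ × Euc (n + 1) => a.2.2) (0, 0, x₀) := by fun_prop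
    have t : ∀ {Y : Type} [TopologicalSpace Y] {g : Euc (n + 1) → Y}, ContinuousAt g x₀ →
        ContinuousAt (fun a : ℝ × ℝ × Euc (n + 1) => g a.2.2) (0, 0, x₀) :=
      fun hg => ContinuousAt.comp (f := fun a : ℝ × ℝ × Euc (n + 1) => a.2.2) hg c1
    have e1 : ContinuousAt (fun a : ℝ × ℝ × Euc (n + 1) => a.1) (0, 0, x₀) := by fun_prop
    have e2 : ContinuousAt (fun a : ℝ × ℝ × Euc (n + 1) => a.2.1) (0, 0, x₀) := by fun_prop
    have hq2 := hqC.contDiffAt (x := x₀)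
    refine ContinuousAt.prodMk ?_ (ContinuousAt.prodMk ?_ (ContinuousAt.prodMk ?_ c1))
    · exact ((t (hφW x₀ hxW).continuousAt_hessianMatrix).add
        (e1.smul (t hq2.continuousAt_hessianMatrix))).add
        (e2.smul (t (hhW x₀ hxW).continuousAt_hessianMatrix))
    · exact ((t (hφW x₀ hxW).continuousAt_gradient).add
        (e1.smul (t hq2.continuousAt_gradient))).add
        (e2.smul (t (hhW x₀ hxW).continuousAt_gradient))
    · exact t (huW.continuousAt (hWo.mem_nhds hxW))
  have hevm := hHmC.eventually_lt (Or.inr hx₀) hpos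
  have hevp := hHpC.eventually_lt (c := -C) (Or.inr hx₀)
    (show -C < Hp (hessianMatrix φ x₀) (gradient φ x₀) (φ x₀) x₀ by
      have := neg_abs_le (evalOp2 Hp φ x₀)
      simp only [evalOp2] at this hC
      linarith)
  have hP0 : (hessianMatrix φ x₀, gradient φ x₀, φ x₀, x₀) =
      ((hessianMatrix φ x₀ + (0 : ℝ) • hessianMatrix q x₀ + (0 : ℝ) • hessianMatrix h x₀,
        gradient φ x₀ + (0 : ℝ) • gradient q x₀ + (0 : ℝ) • gradient h x₀, u x₀, x₀) :
        Matrix (Fin (n + 1)) (Fin (n + 1)) ℝ × Euc (n + 1) × ℝ × Euc (n + 1)) := by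
    simp [hux]
  rw [hP0] at hevm hevp
  have hevg : ∀ᶠ y in 𝓝 x₀, m < ‖gradient h y‖ ^ 2 :=
    ((hhW x₀ hxW).continuousAt_gradient.norm.pow 2).eventually_const_lt hm
  have hevh : ∀ᶠ y in 𝓝 x₀, |h y| < 1 := by
    have : ContinuousAt (fun y => |h y|) x₀ := (hhW x₀ hxW).continuousAt.abs
    exact this.eventually_lt_const (by simp [hh0])
  obtain ⟨ρ₁, hρ₁, hball₁⟩ := Metric.eventually_nhds_iff.1
    ((hP.tendsto.eventually hevm).and (hP.tendsto.eventually hevp))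
  obtain ⟨ρ₂, hρ₂, hball₂⟩ := Metric.eventually_nhds_iff.1
    ((hevg.and hevh).and (hWo.mem_nhds hxW))
  obtain ⟨δ, hδ, hδlt⟩ : ∃ δ : ℝ, 0 < δ ∧ δ < min ρ₁ ρ₂ := exists_between (lt_min hρ₁ hρ₂)
  have hδ₁ : δ < ρ₁ := hδlt.trans_le (min_le_left _ _)
  have hδ₂ : δ < ρ₂ := hδlt.trans_le (min_le_right _ _)
  obtain ⟨s, hs, hslt⟩ : ∃ s : ℝ, 0 < s ∧ s < min (ρ₁ / (3 * K)) (δ * δ ^ 2 / (3 * K)) :=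
    exists_between (by positivity)
  have hs₁ : 3 * K * s < ρ₁ := by
    have := (lt_div_iff₀ (by positivity)).1 (hslt.trans_le (min_le_left _ _))
    linarith
  have hs₂ : 3 * K * s < δ * δ ^ 2 := by
    have := (lt_div_iff₀ (by positivity)).1 (hslt.trans_le (min_le_right _ _))
    linarith
  -- the boundary layer
  set f : ℝ → ℝ → ℝ := fun c t => K * s ^ 2 * (3 * (t / s) + 1 - Real.exp (t / s)) + c with hf
  set f₁ : ℝ → ℝ := fun t => K * s * (3 - Real.exp (t / s)) with hf₁
  set f₂ : ℝ → ℝ := fun t => -(K * Real.exp (t / s)) with hf₂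
  have hdf : ∀ c t, HasDerivAt (f c) (f₁ t) t := by
    intro c t
    have h1 : HasDerivAt (fun t : ℝ => t / s) (1 / s) t := (hasDerivAt_id t).div_const s
    have h2 := ((((h1.const_mul 3).add_const 1).sub h1.exp).const_mul (K * s ^ 2)).add_const c
    refine h2.congr_deriv ?_
    simp only [hf₁]
    field_simp
  have hdf₁ : ∀ t, HasDerivAt f₁ (f₂ t) t := by
    intro t
    have h1 : HasDerivAt (fun t : ℝ => t / s) (1 / s) t := (hasDerivAt_id t).div_const s
    have h2 := (h1.exp.const_sub 3).const_mul (K * s)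
    refine h2.congr_deriv ?_
    simp only [hf₂]
    field_simp
  have hfC : ∀ c, ContDiff ℝ 2 (f c) := fun c => by
    simp only [hf]
    fun_prop
  have hW_of : ∀ y ∈ closedBall x₀ δ, y ∈ W ∧ m < ‖gradient h y‖ ^ 2 ∧ |h y| < 1 := by
    intro y hy
    obtain ⟨⟨h1, h2⟩, h3⟩ := hball₂ ((mem_closedBall.1 hy).trans_lt hδ₂)
    exact ⟨h3, h1, h2⟩
  set F : Euc (n + 1) → ℝ := fun y => u y - (φ y + δ * q y + f 0 (h y)) with hF
  have hFC : ContinuousOn F (closedBall x₀ δ) := by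
    intro y hy
    have hyW := (hW_of y hy).1
    refine ((huW y hyW).mono fun z hz => (hW_of z hz).1).sub (ContinuousAt.continuousWithinAt ?_)
    exact ((hφW y hyW).continuousAt.add (hqC.continuous.continuousAt.const_mul δ)).add
      ((hfC 0).continuous.continuousAt.comp (hhW y hyW).continuousAt)
  have hhc : ContinuousOn h (closedBall x₀ δ) := fun y hy =>
    (hhW y (hW_of y hy).1).continuousAt.continuousWithinAt
  set N : Set (Euc (n + 1)) := closedBall x₀ δ ∩ h ⁻¹' Iic s with hN
  have hNc : IsCompact N := (isCompact_closedBall x₀ δ).of_isClosed_subset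
    (hhc.preimage_isClosed_of_isClosed isClosed_closedBall isClosed_Iic) inter_subset_left
  have hxN : x₀ ∈ N := ⟨mem_closedBall_self hδ.le, by simp [hh0, hs.le]⟩
  obtain ⟨y, hyN, hymax⟩ := hNc.exists_isMaxOn ⟨x₀, hxN⟩ (hFC.mono inter_subset_left)
  have hFx : F x₀ = 0 := by simp [hF, hf, hq, hh0, hux]
  have hFy : 0 ≤ F y := hFx ▸ hymax hxN
  obtain ⟨hyW, hyg, hyh⟩ := hW_of y hyN.1
  have huy := hle y hyW.1
  have hys : h y ≤ s := hyN.2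
  have hlt : h y < s := by
    refine lt_of_le_of_ne hys fun hes => ?_
    have hqy : 0 ≤ δ * q y := by positivity
    have hfpos : 0 < f 0 (h y) := by
      simp only [hf, hes, div_self hs.ne']
      have := Real.exp_one_lt_d9
      have : 0 < 3 * 1 + 1 - Real.exp 1 := by linarith
      positivity
    simp only [hF] at hFy
    linarith
  have hyb : y ∈ ball x₀ δ := by
    refine mem_ball.2 (lt_of_le_of_ne (mem_closedBall.1 hyN.1) fun hes => ?_)
    have hqy : q y = δ ^ 2 := by simp only [hq, ← dist_eq_norm, hes]
    have hflow : -(3 * K * s) < f 0 (h y) := by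
      simp only [hf, add_zero]
      rcases le_total 0 (h y) with h0 | h0
      · have e1 : h y / s ≤ 1 := (div_le_one hs).2 hys
        have e0 : 0 ≤ h y / s := by positivity
        have : 0 ≤ 3 * (h y / s) + 1 - Real.exp (h y / s) := by
          have h1 := Real.exp_one_lt_d9
          have hconv := convexOn_exp.2 (mem_univ (0 : ℝ)) (mem_univ 1) (sub_nonneg.2 e1) e0
            (by ring)
          simp only [smul_eq_mul, mul_zero, mul_one, zero_add, Real.exp_zero] at hconv
          nlinarith
        have : 0 ≤ K * s ^ 2 * (3 * (h y / s) + 1 - Real.exp (h y / s)) := by positivity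
        have : 0 < 3 * K * s := by positivity
        linarith
      · have e0 : h y / s ≤ 0 := div_nonpos_of_nonpos_of_nonneg h0 hs.le
        have e1 : Real.exp (h y / s) ≤ 1 := Real.exp_le_one_iff.2 e0
        have e2 : K * s ^ 2 * (3 * (h y / s)) = 3 * K * s * h y := by field_simp
        have e3 : -1 < h y := (abs_lt.1 hyh).1
        have e4 : 0 ≤ K * s ^ 2 * (1 - Real.exp (h y / s)) :=
          mul_nonneg (by positivity) (by linarith)
        have e5 : 0 < 3 * K * s * (h y + 1) := mul_pos (by positivity) (by linarith)
        linarith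
    simp only [hF, hqy] at hFy
    linarith
  -- the perturbed test function touches at `y`
  set ψ : Euc (n + 1) → ℝ := fun z => φ z + δ * q z + f (F y) (h z) with hψ
  have hfc : ∀ c t, f c t = f 0 t + c := fun c t => by simp [hf]
  have hψy : u y = ψ y := by
    simp only [hψ, hF, hf]
    ring
  have hopen : IsOpen (ball x₀ δ ∩ h ⁻¹' Iio s) :=
    (hhc.mono ball_subset_closedBall).isOpen_inter_preimage isOpen_ball isOpen_Iio
  obtain ⟨ρ, hρ, hball'⟩ := Metric.isOpen_iff.1 hopen y ⟨hyb, hlt⟩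
  have hWball : ∀ z ∈ ball y ρ, z ∈ W := fun z hz =>
    (hW_of z (ball_subset_closedBall (hball' hz).1)).1
  have htest : SubTest Ω u y ψ ρ := by
    refine ⟨hρ, fun z hz => hrΩ (hWball z hz).1, fun z hz => ?_, fun z hz => ?_, hψy⟩
    · refine ContDiffAt.contDiffWithinAt ?_
      have hz := hWball z hz
      exact ((hφW z hz).add (contDiffAt_const.mul hqC.contDiffAt)).add
        ((hfC _).contDiffAt.comp z (hhW z hz))
    · have hz' : z ∈ N := ⟨ball_subset_closedBall (hball' hz).1, le_of_lt (show h z < s from (hball' hz).2)⟩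
      have := hymax hz'
      simp only [hψ, hfc (F y)]
      simp only [hF, mem_ofPred_eq] at this ⊢
      linarith
  obtain ⟨hs1, hs2, hs3⟩ := hsub y ψ ρ htest
  set k : ℝ := K * Real.exp (h y / s) with hk
  have hk0 : 0 ≤ k := by positivity
  set b : ℝ := f₁ (h y) with hb
  have hexp3 : Real.exp (h y / s) ≤ 3 := by
    have h1 := Real.exp_one_lt_d9
    have h2 : Real.exp (h y / s) ≤ Real.exp 1 := Real.exp_le_exp.2 ((div_le_one hs).2 hys)
    linarith
  have hb0 : 0 ≤ b := mul_nonneg (by positivity) (by linarith)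
  have hb1 : b ≤ 3 * K * s := by
    have : 0 ≤ K * s * Real.exp (h y / s) := by positivity
    simp only [hb, hf₁]
    linarith
  have hdist : dist ((δ, b, y) : ℝ × ℝ × Euc (n + 1)) (0, 0, x₀) < ρ₁ := by
    simp only [Prod.dist_eq, max_lt_iff, Real.dist_eq, sub_zero, abs_of_pos hδ, abs_of_nonneg hb0]
    exact ⟨hδ₁, hb1.trans_lt hs₁, (mem_ball.1 hyb).trans hδ₁⟩
  obtain ⟨hVm, hVp⟩ := hball₁ hdist
  dsimp only at hVm hVp
  have hhess : hessianMatrix ψ y = (hessianMatrix φ y + δ • hessianMatrix q y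
      + b • hessianMatrix h y) - k • Matrix.vecMulVec (gradient h y).ofLp (gradient h y).ofLp := by
    rw [hψ, hessianMatrix_add_mul_add_comp (hφW y hyW) hqC.contDiffAt (hhW y hyW) (hdf _) hdf₁ δ,
      sub_eq_add_neg, ← neg_smul]
  have hgrad : gradient ψ y = gradient φ y + δ • gradient q y + b • gradient h y :=
    gradient_add_mul_add_comp ((hφW y hyW).differentiableAt (by norm_num))
      (hqC.contDiffAt.differentiableAt (by norm_num))
      ((hhW y hyW).differentiableAt (by norm_num)) (hdf _) δ
  have hposm : y ∈ Ωm ∪ Γ → 0 < evalOp2 Hm ψ y := fun hy => by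
    have h1 := hHm (hessianMatrix φ y + δ • hessianMatrix q y + b • hessianMatrix h y)
      (gradient h y) (gradient ψ y) (ψ y) k y hy hk0
    rw [← hhess] at h1
    have h2 := hVm hy
    rw [← hgrad, hψy] at h2
    rw [zero_mul, zero_mul, add_zero] at h1
    exact h2.trans_le h1
  have hposp : 0 ≤ h y → y ∈ Ωp ∪ Γ → 0 < evalOp2 Hp ψ y := fun h0 hy => by
    have h1 := hHp (hessianMatrix φ y + δ • hessianMatrix q y + b • hessianMatrix h y)
      (gradient h y) (gradient ψ y) (ψ y) k y hy hk0
    rw [← hhess] at h1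
    have h2 := hVp hy
    rw [← hgrad, hψy] at h2
    have hKk : K ≤ k := le_mul_of_one_le_right hKpos.le (Real.one_le_exp (by positivity))
    have h3 : C ≤ lam * k * ‖gradient h y‖ ^ 2 := by
      rw [← hKC]
      gcongr
    have : 0 < Hp (hessianMatrix ψ y) (gradient ψ y) (ψ y) y := by linarith
    exact this
  obtain ⟨sm, sp, s0⟩ := hside y hyW.2
  rcases lt_trichotomy (h y) 0 with hy0 | hy0 | hy0
  · exact (hs1 (sm hy0)).not_gt (hposm (Or.inl (sm hy0)))
  · exact (hs3 (s0 hy0)).not_gt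
      (lt_min (hposm (Or.inr (s0 hy0))) (hposp hy0.ge (Or.inr (s0 hy0))))
  · exact (hs2 (sp hy0)).not_gt (hposp hy0.le (Or.inl (sp hy0)))

theorem relaxedSub2_iff_strongSub2 {n : ℕ} {lam : ℝ} (hlam : 0 < lam)
    {Ω Ωp Ωm Γ : Set (Euc (n + 1))} (hC2 : C2Interface Ωm Ωp Γ)
    {Hm Hp : Matrix (Fin (n + 1)) (Fin (n + 1)) ℝ → Euc (n + 1) → ℝ → Euc (n + 1) → ℝ}
    (hHm : RankOneMono 0 (Ωm ∪ Γ) Hm) (hHmC : ContinuousOp2 (Ωm ∪ Γ) Hm)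
    (hHp : RankOneMono lam (Ωp ∪ Γ) Hp) (hHpC : ContinuousOp2 (Ωp ∪ Γ) Hp)
    {u : Euc (n + 1) → ℝ} (hu : ContinuousOn u Ω) :
    RelaxedSub2 Ω Ωm Ωp Γ Hm Hp u ↔ StrongSub2 Ω Ωm Ωp Γ Hm Hp u := by
  refine ⟨fun h x₀ φ r hφ => ⟨?_, (h x₀ φ r hφ).2.1⟩, fun h x₀ φ r hφ => ?_⟩
  · rintro (hx | hx)
    · exact (h x₀ φ r hφ).1 hx
    · exact h.evalOp2_nonpos_of_mem_interface hlam hC2 hHm hHmC hHp hHpC hu hx hφ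
  · obtain ⟨h1, h2⟩ := h x₀ φ r hφ
    exact ⟨fun hx => h1 (Or.inl hx), h2, fun hx => min_le_of_left_le (h1 (Or.inr hx))⟩

/-- The operator whose sub-solutions are the negatives of the super-solutions of `H`. -/
def dualOp2 {n : ℕ} (H : Matrix (Fin n) (Fin n) ℝ → Euc n → ℝ → Euc n → ℝ) :
    Matrix (Fin n) (Fin n) ℝ → Euc n → ℝ → Euc n → ℝ :=
  fun M p z x => -H (-M) (-p) (-z) x

section Duality

variable {n : ℕ} {H : Matrix (Fin n) (Fin n) ℝ → Euc n → ℝ → Euc n → ℝ} {S : Set (Euc n)}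

theorem RankOneMono.dualOp2 {c : ℝ} (hH : RankOneMono c S H) : RankOneMono c S (dualOp2 H) := by
  intro M v p z k x hx hk
  have h := hH (-M + k • Matrix.vecMulVec v v) v (-p) (-z) k x hx hk
  rw [add_sub_cancel_right] at h
  simp only [_root_.dualOp2, neg_sub', sub_neg_eq_add]
  linarith

theorem ContinuousOp2.dualOp2 (hH : ContinuousOp2 S H) : ContinuousOp2 S (dualOp2 H) := by
  refine ContinuousOn.neg (ContinuousOn.comp hH
    (f := fun q : Matrix (Fin n) (Fin n) ℝ × Euc n × ℝ × Euc n =>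
      (-q.1, -q.2.1, -q.2.2.1, q.2.2.2)) (by fun_prop) ?_)
  intro q hq
  simpa using hq

theorem evalOp2_dualOp2_neg (φ : Euc n → ℝ) (x : Euc n) :
    evalOp2 (dualOp2 H) (-φ) x = -evalOp2 H φ x := by
  simp [evalOp2, dualOp2, hessianMatrix_neg, gradient_neg]

theorem subTest_neg_iff {Ω : Set (Euc n)} {u φ : Euc n → ℝ} {x₀ : Euc n} {r : ℝ} :
    SubTest Ω (-u) x₀ (-φ) r ↔ SupTest Ω u x₀ φ r := by
  have h : ContDiffOn ℝ 2 (-φ) (ball x₀ r) ↔ ContDiffOn ℝ 2 φ (ball x₀ r) :=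
    ⟨fun h => by simpa using h.neg, fun h => h.neg⟩
  simp [SubTest, SupTest, h]

variable {Ω Ωm Ωp Γ : Set (Euc n)} {Hm Hp : Matrix (Fin n) (Fin n) ℝ → Euc n → ℝ → Euc n → ℝ}
  {u : Euc n → ℝ}

theorem relaxedSub2_dualOp2_neg_iff :
    RelaxedSub2 Ω Ωm Ωp Γ (dualOp2 Hm) (dualOp2 Hp) (-u) ↔ RelaxedSuper2 Ω Ωm Ωp Γ Hm Hp u := by
  refine forall_congr' fun x₀ => ((Equiv.neg (Euc n → ℝ)).forall_congr_left).trans ?_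
  simp [subTest_neg_iff, evalOp2_dualOp2_neg]

theorem strongSub2_dualOp2_neg_iff :
    StrongSub2 Ω Ωm Ωp Γ (dualOp2 Hm) (dualOp2 Hp) (-u) ↔ StrongSuper2 Ω Ωm Ωp Γ Hm Hp u := by
  refine forall_congr' fun x₀ => ((Equiv.neg (Euc n → ℝ)).forall_congr_left).trans ?_
  simp [subTest_neg_iff, evalOp2_dualOp2_neg]

end Duality

theorem statement_0 {n : ℕ} (lam Lam : ℝ) (hlam : 0 < lam) (hLam : lam ≤ Lam)
    (Ω Ωp Ωm Γ : Set (Euc (n + 1)))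
    (hΩ : IsOpen Ω) (hΩpO : IsOpen Ωp) (hΩpsub : Ωp ⊆ Ω)
    (hΩm : Ωm = Ω \ closure Ωp)
    (hΓ : Γ = Ω \ (Ωp ∪ Ωm))
    (hΓm : Γ = frontier Ωm ∩ Ω) (hΓp : Γ = frontier Ωp ∩ Ω)
    (hC2 : C2Interface Ωm Ωp Γ)
    (Hm Hp : Matrix (Fin (n + 1)) (Fin (n + 1)) ℝ → Euc (n + 1) → ℝ → Euc (n + 1) → ℝ)
    (hHmDE : DegElliptic2 (Ωm ∪ Γ) Hm) (hHmC : ContinuousOp2 (Ωm ∪ Γ) Hm)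
    (hHpDE : DegElliptic2 (Ωp ∪ Γ) Hp) (hHpC : ContinuousOp2 (Ωp ∪ Γ) Hp)
    (hHpUE : UnifElliptic2 lam Lam (Ωp ∪ Γ) Hp)
    (u : Euc (n + 1) → ℝ) (hu : ContinuousOn u Ω) :
    (RelaxedSub2 Ω Ωm Ωp Γ Hm Hp u ↔ StrongSub2 Ω Ωm Ωp Γ Hm Hp u) ∧
      (RelaxedSuper2 Ω Ωm Ωp Γ Hm Hp u ↔ StrongSuper2 Ω Ωm Ωp Γ Hm Hp u) ∧
      ((RelaxedSub2 Ω Ωm Ωp Γ Hm Hp u ∧ RelaxedSuper2 Ω Ωm Ωp Γ Hm Hp u) ↔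
        (StrongSub2 Ω Ωm Ωp Γ Hm Hp u ∧ StrongSuper2 Ω Ωm Ωp Γ Hm Hp u)) := by
  have hm := hHmDE.rankOneMono
  have hp := hHpUE.rankOneMono hLam
  have hsub := relaxedSub2_iff_strongSub2 hlam hC2 hm hHmC hp hHpC hu
  have hsup := relaxedSub2_iff_strongSub2 hlam hC2 hm.dualOp2 hHmC.dualOp2 hp.dualOp2
    hHpC.dualOp2 hu.neg
  rw [relaxedSub2_dualOp2_neg_iff,
    strongSub2_dualOp2_neg_iff] at hsup
  exact ⟨hsub, hsup, and_congr hsub hsup⟩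

end
end

section
/- Let Ω = B₁ ⊆ ℝⁿ, Ω± = B₁∩{±xₙ>0}, Γ = B₁∩{xₙ=0}. Let H₋ be a degenerate elliptic second-order operator on Ω₋∪Γ and H₊ a degenerate elliptic second-order operator on Ω₊∪Γ that is uniformly elliptic with respect to some [λ,Λ] ⊆ (0,∞). Let φ ∈ C(B₁) be such that its restrictions φ₋ to B₁∩{xₙ≤0} and φ₊ to B₁∩{xₙ≥0} are C² up to Γ, and suppose min( H₋(D²φ₊(0), Dφ₊(0), φ(0), 0), ∂ₙφ₋(0) − ∂ₙφ₊(0) ) > 0. Then there exist ρ ∈ (0,1) and a test function ψ ∈ C²(B_ρ) that touches φ from above at the origin on B_ρ and satisfies min(H₋ψ(0), H₊ψ(0)) > 0. -/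
open Metric Set Filter Topology Bornology

noncomputable section

/-- Gradient within a set, as a vector of `ℝⁿ`. -/
def gradWithinE {n : ℕ} (S : Set (Euc n)) (φ : Euc n → ℝ) (x : Euc n) : Euc n :=
  (EuclideanSpace.equiv (Fin n) ℝ).symm fun i =>
    fderivWithin ℝ φ S x (EuclideanSpace.single i (1 : ℝ))

/-- Hessian matrix within a set. -/
def hessWithinE {n : ℕ} (S : Set (Euc n)) (φ : Euc n → ℝ) (x : Euc n) :
    Matrix (Fin n) (Fin n) ℝ :=
  Matrix.of fun i j =>
    fderivWithin ℝ (fun y => fderivWithin ℝ φ S y) S x (EuclideanSpace.single i (1 : ℝ))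
      (EuclideanSpace.single j (1 : ℝ))

/-- Normal (last-coordinate) derivative within a set. -/
def dnWithin {n : ℕ} (S : Set (Euc (n + 1))) (φ : Euc (n + 1) → ℝ) (x : Euc (n + 1)) : ℝ :=
  fderivWithin ℝ φ S x (EuclideanSpace.single (Fin.last n) (1 : ℝ))

/-- `B₁ ∩ {xₙ < 0}`. -/
def flatOmegaM (n : ℕ) : Set (Euc (n + 1)) := ball 0 1 ∩ {x | x (Fin.last n) < 0}
/-- `B₁ ∩ {xₙ > 0}`. -/
def flatOmegaP (n : ℕ) : Set (Euc (n + 1)) := ball 0 1 ∩ {x | 0 < x (Fin.last n)}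
/-- `B₁ ∩ {xₙ = 0}`. -/
def flatGamma (n : ℕ) : Set (Euc (n + 1)) := ball 0 1 ∩ {x | x (Fin.last n) = 0}
/-- `B₁ ∩ {xₙ ≤ 0}`. -/
def flatSm (n : ℕ) : Set (Euc (n + 1)) := ball 0 1 ∩ {x | x (Fin.last n) ≤ 0}
/-- `B₁ ∩ {xₙ ≥ 0}`. -/
def flatSp (n : ℕ) : Set (Euc (n + 1)) := ball 0 1 ∩ {x | 0 ≤ x (Fin.last n)}

section Calculus

variable {E : Type*} [NormedAddCommGroup E] [NormedSpace ℝ E]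

/-- A `C¹` function on a convex set decreases near `0` along any direction in which its
derivative at `0` is negative. -/
lemma exists_ball_decreasing_along {S : Set E} {f : E → ℝ} (hS : Convex ℝ S)
    (hU : UniqueDiffOn ℝ S) (h0 : (0 : E) ∈ S) (hf : ContDiffOn ℝ 1 f S) {v : E}
    (hv : fderivWithin ℝ f S 0 v < 0) :
    ∃ r > 0, ∀ x ∈ S ∩ ball 0 r, ∀ s : ℝ, 0 ≤ s → x + s • v ∈ S ∩ ball 0 r →
      f (x + s • v) ≤ f x := by
  set L := fderivWithin ℝ f S 0
  have hη : 0 < -L v / (‖v‖ + 1) := div_pos (by linarith) (by positivity)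
  have hc : ContinuousWithinAt (fderivWithin ℝ f S) S 0 :=
    hf.continuousOn_fderivWithin hU le_rfl 0 h0
  obtain ⟨r, hr, hball⟩ := Metric.continuousWithinAt_iff.1 hc _ hη
  refine ⟨r, hr, fun x hx s hs hxs => ?_⟩
  have key := (hS.inter (convex_ball 0 r)).norm_image_sub_le_of_norm_hasFDerivWithin_le'
    (f := f) (f' := fderivWithin ℝ f S) (φ := L) (C := -L v / (‖v‖ + 1))
    (fun y hy => ((hf.differentiableOn one_ne_zero y hy.1).hasFDerivWithinAt).mono
      inter_subset_left)
    (fun y hy => by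
      have := hball hy.1 (by simpa using hy.2)
      rw [dist_eq_norm] at this
      exact this.le) hx hxs
  rw [add_sub_cancel_left, map_smul, norm_smul, Real.norm_eq_abs, Real.norm_eq_abs,
    abs_of_nonneg hs, smul_eq_mul] at key
  have h1 : -L v / (‖v‖ + 1) * ‖v‖ ≤ -L v := by
    rw [div_mul_eq_mul_div, div_le_iff₀ (by positivity)]
    nlinarith
  have h2 := (le_abs_self _).trans key
  nlinarith [mul_le_mul_of_nonneg_left h1 hs]

/-- Derivative of a quadratic polynomial with symmetric quadratic part. -/
lemma hasFDerivAt_quadratic (c : ℝ) (L : E →L[ℝ] ℝ) (B : E →L[ℝ] E →L[ℝ] ℝ)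
    (hB : ∀ x y, B x y = B y x) (x : E) :
    HasFDerivAt (fun y => c + L y + 1 / 2 * B y y) (L + B x) x := by
  have h := ((L.hasFDerivAt (x := x)).const_add c).add
    (((B.hasFDerivAt (x := x)).clm_apply (hasFDerivAt_id x)).const_mul (1 / 2))
  refine h.congr_fderiv ?_
  ext y
  simp [hB y x]
  ring

/-- Second-order Taylor expansion at `0` of a `C²` function on a convex set, as an upper bound. -/
lemma exists_ball_taylor_upper {S : Set E} {f : E → ℝ} (hS : Convex ℝ S)
    (hU : UniqueDiffOn ℝ S) (h0 : (0 : E) ∈ S) (hf : ContDiffOn ℝ 2 f S)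
    (hsymm : IsSymmSndFDerivWithinAt ℝ f S 0) {ε : ℝ} (hε : 0 < ε) :
    ∃ r > 0, ∀ x ∈ S ∩ ball 0 r,
      f x ≤ f 0 + fderivWithin ℝ f S 0 x +
        1 / 2 * fderivWithin ℝ (fderivWithin ℝ f S) S 0 x x + ε * ‖x‖ ^ 2 := by
  set L := fderivWithin ℝ f S 0
  set D := fderivWithin ℝ (fderivWithin ℝ f S) S 0
  have hD : HasFDerivWithinAt (fderivWithin ℝ f S) D S 0 :=
    ((hf.fderivWithin hU (m := 1) (by norm_num)).differentiableOn one_ne_zero 0 h0).hasFDerivWithinAt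
  have ho := hD.isLittleO.def hε
  rw [Filter.Eventually, Metric.mem_nhdsWithin_iff] at ho
  obtain ⟨r, hr, hball⟩ := ho
  refine ⟨r, hr, fun x hx => ?_⟩
  have hxr : ‖x‖ < r := by simpa using hx.2
  have key := (hS.inter (convex_closedBall 0 ‖x‖)).norm_image_sub_le_of_norm_hasFDerivWithin_le
    (f := fun y => f y - (f 0 + L y + 1 / 2 * D y y))
    (f' := fun y => fderivWithin ℝ f S y - (L + D y)) (C := ε * ‖x‖) (x := 0) (y := x)
    (fun y hy => (((hf.differentiableOn two_ne_zero y hy.1).hasFDerivWithinAt).mono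
      inter_subset_left).sub (hasFDerivAt_quadratic _ _ _ hsymm y).hasFDerivWithinAt)
    (fun y hy => by
      have hy2 : ‖y‖ ≤ ‖x‖ := by simpa using hy.2
      have := @hball y ⟨by simpa using hy2.trans_lt hxr, hy.1⟩
      simp only [mem_ofPred_eq, sub_zero] at this
      rw [← sub_sub]
      exact this.trans (by gcongr))
    ⟨h0, by simp⟩ ⟨hx.1, by simp⟩
  have h2 := (le_abs_self _).trans key
  simp only [map_zero, sub_zero, add_zero, mul_zero, sub_self] at h2
  nlinarith

/-- The intersection of the unit ball with a closed half-space is convex with nonempty interior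
and contains `0`. -/
lemma convex_ball_inter_halfspace {l : E →L[ℝ] ℝ} {v : E} (hv : ‖v‖ < 1) (hlv : 0 < l v) :
    Convex ℝ (ball (0 : E) 1 ∩ {x | 0 ≤ l x}) ∧
      (interior (ball (0 : E) 1 ∩ {x | 0 ≤ l x})).Nonempty ∧
      (0 : E) ∈ ball (0 : E) 1 ∩ {x | 0 ≤ l x} := by
  refine ⟨(convex_ball 0 1).inter (convex_halfSpace_ge l.isLinear 0), ⟨v, ?_⟩, by simp⟩
  rw [mem_interior]
  refine ⟨ball 0 1 ∩ {x | 0 < l x}, fun x hx => ⟨hx.1, show 0 ≤ l x from le_of_lt hx.2⟩,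
    isOpen_ball.inter (isOpen_lt continuous_const l.continuous), by simpa using hv, hlv⟩

end Calculus

/-- Gradient of a quadratic polynomial at the origin. -/
lemma gradient_quadratic_zero {n : ℕ} (c : ℝ) (L : Euc n →L[ℝ] ℝ)
    (B : Euc n →L[ℝ] Euc n →L[ℝ] ℝ) (hB : ∀ x y, B x y = B y x) (i : Fin n) :
    gradient (fun y => c + L y + 1 / 2 * B y y) 0 i = L (EuclideanSpace.single i 1) := by
  have h : inner ℝ (gradient (fun y => c + L y + 1 / 2 * B y y) 0)
      (EuclideanSpace.single i (1 : ℝ)) = L (EuclideanSpace.single i 1) := by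
    rw [gradient, InnerProductSpace.toDual_symm_apply, (hasFDerivAt_quadratic c L B hB 0).fderiv]
    simp
  rw [← h, EuclideanSpace.inner_single_right]
  simp only [conj_trivial, one_mul]

/-- Hessian of a quadratic polynomial. -/
lemma hessianMatrix_quadratic {n : ℕ} (c : ℝ) (L : Euc n →L[ℝ] ℝ)
    (B : Euc n →L[ℝ] Euc n →L[ℝ] ℝ) (hB : ∀ x y, B x y = B y x) (x : Euc n) :
    hessianMatrix (fun y => c + L y + 1 / 2 * B y y) x =
      Matrix.of fun i j => B (EuclideanSpace.single i 1) (EuclideanSpace.single j 1) := by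
  have h : fderiv ℝ (fun y => c + L y + 1 / 2 * B y y) = fun y => L + B y :=
    funext fun y => (hasFDerivAt_quadratic c L B hB y).fderiv
  ext i j
  simp only [hessianMatrix, Matrix.of_apply, iteratedFDeriv_two_apply, h]
  rw [(B.hasFDerivAt.const_add L).fderiv]
  simp

/-- The minimal Pucci operator of `-K` times a coordinate projection is at least `l * K`. -/
lemma le_pucciMinus_neg_diagonal_single {n : ℕ} {l L K : ℝ} (hl : l ≤ L) (hK : 0 ≤ K)
    (i : Fin n) :
    l * K ≤ pucciMinus l L (-(K • Matrix.diagonal (Pi.single i (1 : ℝ)))) := by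
  refine le_csInf (Set.Nonempty.image _ ⟨l • 1, ?_, ?_⟩) ?_
  · simpa using Matrix.PosSemidef.zero
  · rw [← sub_smul]
    exact Matrix.PosSemidef.one.smul (sub_nonneg.2 hl)
  · rintro _ ⟨A, hA, rfl⟩
    have h : l ≤ A i i := by simpa using hA.1.diag_nonneg (i := i)
    have ht : -(A * -(K • Matrix.diagonal (Pi.single i (1 : ℝ)))).trace = K * A i i := by
      simp [Matrix.trace, Matrix.mul_diagonal, Pi.single_apply]
    simp only [ht]
    nlinarith

/-- Removing the last coordinate does not increase the Euclidean norm. -/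
lemma norm_sub_smul_single_last_le {n : ℕ} (x : Euc (n + 1)) :
    ‖x - x (Fin.last n) • EuclideanSpace.single (Fin.last n) (1 : ℝ)‖ ≤ ‖x‖ := by
  refine le_of_sq_le_sq ?_ (norm_nonneg _)
  rw [norm_sub_sq_real, inner_smul_right, norm_smul]
  simp [EuclideanSpace.inner_single_right]
  nlinarith [sq_nonneg (x (Fin.last n))]

/-- A `C²` function on a convex set with nonempty interior has symmetric second derivative. -/
lemma isSymmSndFDerivWithinAt_of_convex {E : Type*} [NormedAddCommGroup E] [NormedSpace ℝ E]
    {S : Set E} {f : E → ℝ} {x : E} (hS : Convex ℝ S) (hne : (interior S).Nonempty)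
    (hx : x ∈ S) (hf : ContDiffOn ℝ 2 f S) : IsSymmSndFDerivWithinAt ℝ f S x :=
  (hf x hx).isSymmSndFDerivWithinAt (by simp) (uniqueDiffOn_convex hS hne)
    (hS.closure_interior_eq_closure_of_nonempty_interior hne ▸ subset_closure hx) hx

theorem statement_1 {n : ℕ} (lam Lam : ℝ) (hlam : 0 < lam) (hLam : lam ≤ Lam)
    (Hm Hp : Matrix (Fin (n + 1)) (Fin (n + 1)) ℝ → Euc (n + 1) → ℝ → Euc (n + 1) → ℝ)
    (hHmDE : DegElliptic2 (flatOmegaM n ∪ flatGamma n) Hm)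
    (hHmC : ContinuousOp2 (flatOmegaM n ∪ flatGamma n) Hm)
    (hHpDE : DegElliptic2 (flatOmegaP n ∪ flatGamma n) Hp)
    (hHpC : ContinuousOp2 (flatOmegaP n ∪ flatGamma n) Hp)
    (hHpUE : UnifElliptic2 lam Lam (flatOmegaP n ∪ flatGamma n) Hp)
    (φ : Euc (n + 1) → ℝ)
    (hφc : ContinuousOn φ (ball 0 1))
    (hφm : ContDiffOn ℝ 2 φ (flatSm n)) (hφp : ContDiffOn ℝ 2 φ (flatSp n))
    (hpos : 0 < min
      (Hm (hessWithinE (flatSp n) φ 0) (gradWithinE (flatSp n) φ 0) (φ 0) 0)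
      (dnWithin (flatSm n) φ 0 - dnWithin (flatSp n) φ 0)) :
    ∃ ρ ∈ Ioo (0 : ℝ) 1, ∃ ψ : Euc (n + 1) → ℝ,
      ContDiffOn ℝ 2 ψ (ball 0 ρ) ∧
      (∀ x ∈ ball (0 : Euc (n + 1)) ρ, φ x ≤ ψ x) ∧ φ 0 = ψ 0 ∧
      0 < min (evalOp2 Hm ψ 0) (evalOp2 Hp ψ 0) := by
  obtain ⟨hH, hgap⟩ := lt_min_iff.1 hpos
  set e : Euc (n + 1) := EuclideanSpace.single (Fin.last n) (1 : ℝ) with he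
  set π : Euc (n + 1) →L[ℝ] ℝ := EuclideanSpace.proj (Fin.last n) with hπ
  have hπx : ∀ x, π x = x (Fin.last n) := fun x => rfl
  have hπe : π e = 1 := by simp [hπ, he]
  have hhalf : ‖(1 / 2 : ℝ) • e‖ < 1 := by
    rw [norm_smul, he]
    norm_num
  -- geometry of the two half balls
  obtain ⟨hcp, hip, h0p⟩ := convex_ball_inter_halfspace (l := π) hhalf (by simp [hπe])
  obtain ⟨hcm, him, h0m⟩ := convex_ball_inter_halfspace (l := -π) (v := -((1 / 2 : ℝ) • e))
    (by rwa [norm_neg]) (by simp [hπe])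
  have hSp : ball (0 : Euc (n + 1)) 1 ∩ {x | 0 ≤ π x} = flatSp n := rfl
  have hSm : ball (0 : Euc (n + 1)) 1 ∩ {x | 0 ≤ (-π) x} = flatSm n := by
    ext x
    simp [flatSm, hπx]
  rw [hSp] at hcp hip h0p
  rw [hSm] at hcm him h0m
  have hup := uniqueDiffOn_convex hcp hip
  have hum := uniqueDiffOn_convex hcm him
  have hsymm := isSymmSndFDerivWithinAt_of_convex hcp hip h0p hφp
  have h0Γ : (0 : Euc (n + 1)) ∈ flatGamma n := by simp [flatGamma]
  set L := fderivWithin ℝ φ (flatSp n) 0 with hL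
  set D := fderivWithin ℝ (fderivWithin ℝ φ (flatSp n)) (flatSp n) 0 with hD
  set A := hessWithinE (flatSp n) φ 0 with hA
  set p := gradWithinE (flatSp n) φ 0 with hp
  -- choice of the slope and convexity increment `t`
  have hcont : Continuous fun t : ℝ => Hm (A + t • 1) (p + t • e) (φ 0) 0 :=
    hHmC.comp_continuous (f := fun t : ℝ => (A + t • (1 : Matrix _ _ ℝ), p + t • e, φ 0, 0))
      (by fun_prop) (fun t => ⟨mem_univ _, mem_univ _, mem_univ _, Or.inr h0Γ⟩)
  obtain ⟨t, htH, htgap, ht⟩ : ∃ t : ℝ, 0 < Hm (A + t • 1) (p + t • e) (φ 0) 0 ∧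
      t < dnWithin (flatSm n) φ 0 - dnWithin (flatSp n) φ 0 ∧ 0 < t := by
    have h1 : ∀ᶠ t in 𝓝[>] (0 : ℝ), 0 < Hm (A + t • 1) (p + t • e) (φ 0) 0 :=
      (hcont.continuousAt.eventually_const_lt (by simpa using hH)).filter_mono nhdsWithin_le_nhds
    exact (h1.and ((eventually_nhdsWithin_of_eventually_nhds (eventually_lt_nhds hgap)).and
      self_mem_nhdsWithin)).exists
  -- choice of the normal concavity `K`
  set P : Matrix (Fin (n + 1)) (Fin (n + 1)) ℝ :=
    Matrix.diagonal (Pi.single (Fin.last n) (1 : ℝ)) with hP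
  obtain ⟨K, hK, hKH⟩ : ∃ K : ℝ, 0 ≤ K ∧
      0 < Hp (A + t • 1 - K • P) (p + t • e) (φ 0) 0 := by
    set h := Hp (A + t • 1) (p + t • e) (φ 0) 0
    have hK : 0 ≤ (|h| + 1) / lam := by positivity
    refine ⟨(|h| + 1) / lam, hK, ?_⟩
    have h1 := (hHpUE (A + t • 1) (A + t • 1 - ((|h| + 1) / lam) • P) (p + t • e) (p + t • e)
      (φ 0) (φ 0) 0 (Or.inr h0Γ)).1
    have h2 := le_pucciMinus_neg_diagonal_single hLam hK (Fin.last n)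
    rw [mul_div_cancel₀ _ hlam.ne'] at h2
    rw [sub_sub_cancel_left] at h1
    simp only [sub_self, norm_zero, mul_zero, neg_zero, max_self, sub_zero] at h1
    linarith [neg_abs_le h]
  -- the test function
  set B : Euc (n + 1) →L[ℝ] Euc (n + 1) →L[ℝ] ℝ :=
    D + t • (isBoundedBilinearMap_inner (𝕜 := ℝ)).toContinuousLinearMap - K • π.smulRight π with hB
  have hBapp : ∀ x y, B x y = D x y + t * inner ℝ x y - K * (π x * π y) := fun x y => by
    simp only [hB, add_apply, sub_apply, smul_apply, smul_eq_mul,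
      ContinuousLinearMap.smulRight_apply, IsBoundedBilinearMap.toContinuousLinearMap_apply]
  have hBsymm : ∀ x y, B x y = B y x := fun x y => by
    rw [hBapp, hBapp, hsymm.eq x y, real_inner_comm, mul_comm (π x)]
  set M := L + t • π with hM
  set ψ : Euc (n + 1) → ℝ := fun y => φ 0 + M y + 1 / 2 * B y y with hψ
  have hψ0 : ψ 0 = φ 0 := by simp [hψ]
  have hψd : HasFDerivAt ψ M 0 := by
    simpa only [map_zero, add_zero] using hasFDerivAt_quadratic (φ 0) M B hBsymm 0
  have hψc : ContDiff ℝ 2 ψ := by fun_prop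
  have hgrad : gradient ψ 0 = p + t • e := by
    ext i
    rw [gradient_quadratic_zero _ _ _ hBsymm]
    simp [hM, hp, hπx, he, gradWithinE, hL, eq_comm]
  have hhess : hessianMatrix ψ 0 = A + t • 1 - K • P := by
    rw [hessianMatrix_quadratic _ _ _ hBsymm]
    ext i j
    have h1 : inner ℝ (EuclideanSpace.single i (1 : ℝ)) (EuclideanSpace.single j (1 : ℝ)) =
        (1 : Matrix (Fin (n + 1)) (Fin (n + 1)) ℝ) i j := by
      simp [EuclideanSpace.inner_single_left, Matrix.one_apply]
    have h2 : π (EuclideanSpace.single i 1) * π (EuclideanSpace.single j 1) = P i j := by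
      simp only [hπx, PiLp.single_apply, hP, Matrix.diagonal_apply, Pi.single_apply]
      clear * -
      grind
    simp only [Matrix.of_apply, hBapp, h1, h2]
    rfl
  -- touching from above
  have hsub : ∀ S, UniqueDiffWithinAt ℝ S 0 → DifferentiableWithinAt ℝ φ S 0 →
      fderivWithin ℝ (φ - ψ) S 0 = fderivWithin ℝ φ S 0 - M := fun S hS hd =>
    (hd.hasFDerivWithinAt.sub hψd.hasFDerivWithinAt).fderivWithin hS
  obtain ⟨r₁, hr₁, hdecp⟩ := exists_ball_decreasing_along (f := φ - ψ) (v := e) hcp hup h0p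
    ((hφp.sub hψc.contDiffOn).of_le one_le_two) (by
      rw [hsub _ (hup 0 h0p) (hφp.differentiableOn two_ne_zero 0 h0p)]
      simp [hM, hL, hπe, ht])
  obtain ⟨r₂, hr₂, hdecm⟩ := exists_ball_decreasing_along (f := φ - ψ) (v := -e) hcm hum h0m
    ((hφm.sub hψc.contDiffOn).of_le one_le_two) (by
      rw [hsub _ (hum 0 h0m) (hφm.differentiableOn two_ne_zero 0 h0m)]
      simp only [dnWithin, ← hL, ← he] at htgap
      simp [hM, hπe]
      linarith)
  obtain ⟨r₃, hr₃, htaylor⟩ := exists_ball_taylor_upper hcp hup h0p hφp hsymm (half_pos ht)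
  obtain ⟨ρ, hρ, hρ'⟩ := exists_between (lt_min one_pos (lt_min hr₁ (lt_min hr₂ hr₃)))
  simp only [lt_min_iff] at hρ'
  obtain ⟨hρ1, hρr₁, hρr₂, hρr₃⟩ := hρ'
  refine ⟨ρ, ⟨hρ, hρ1⟩, ψ, hψc.contDiffOn, fun x hx => ?_, hψ0.symm, lt_min ?_ ?_⟩
  · rw [mem_ball_zero_iff] at hx
    set y := x - x (Fin.last n) • e with hy
    have hyx : ‖y‖ ≤ ‖x‖ := norm_sub_smul_single_last_le x
    have hπy : π y = 0 := by
      rw [hy, map_sub, map_smul, hπe, hπx]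
      simp
    have hyp : y ∈ flatSp n := ⟨by rw [mem_ball_zero_iff]; linarith, hπy.ge⟩
    have hym : y ∈ flatSm n := ⟨by rw [mem_ball_zero_iff]; linarith, hπy.le⟩
    have hΓ : (φ - ψ) y ≤ 0 := by
      have := htaylor y ⟨hyp, by rw [mem_ball_zero_iff]; linarith⟩
      simp only [Pi.sub_apply, hψ, hM, hBapp, hπy, real_inner_self_eq_norm_sq,
        add_apply, smul_apply, smul_zero, add_zero]
      simp only [← hL, ← hD] at this
      linarith
    suffices h : (φ - ψ) x ≤ (φ - ψ) y by
      have := h.trans hΓ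
      simp only [Pi.sub_apply] at this
      linarith
    rcases le_total 0 (x (Fin.last n)) with hxn | hxn
    · have hxy : y + x (Fin.last n) • e = x := by simp [hy]
      have := hdecp y ⟨hyp, by rw [mem_ball_zero_iff]; linarith⟩ (x (Fin.last n)) hxn
      rw [hxy] at this
      exact this ⟨⟨by rw [mem_ball_zero_iff]; linarith, hxn⟩, by rw [mem_ball_zero_iff]; linarith⟩
    · have hxy : y + (-x (Fin.last n)) • -e = x := by simp [hy]
      have := hdecm y ⟨hym, by rw [mem_ball_zero_iff]; linarith⟩ (-x (Fin.last n)) (by linarith)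
      rw [hxy] at this
      exact this ⟨⟨by rw [mem_ball_zero_iff]; linarith, hxn⟩, by rw [mem_ball_zero_iff]; linarith⟩
  · rw [evalOp2, hhess, hgrad, hψ0]
    refine htH.trans_le (hHmDE _ _ _ _ _ _ (Or.inr h0Γ) ?_ le_rfl)
    rw [sub_sub_cancel]
    exact (Matrix.PosSemidef.diagonal (Pi.single_nonneg.2 zero_le_one)).smul hK
  · rwa [evalOp2, hhess, hgrad, hψ0]
end
end
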